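/- arXiv:1406.1140 — 8 statements merged into one kernel-verified Lean document; each statement's English description precedes it below -/
import Mathlib

section
/- Let g1 > g2 > 0, f2 > 0, f3 > 0, R2 > 0 and R3 ≥ 0 be real numbers. Set s = f2 + f3, Rp = f3·R3/s and Rc = f2·R2/s. Then s·[(2^(Rc+Rp) − 2^Rc)/g1 + (2^Rc − 1)/g2] < f2·(2^R2 − 1)/g2 + f3·(2^R3 − 1)/g1. (This is the key inequality in the proof of Lemma 3: on a downlink with receiver gains g1 > g2, superposition coding of the network-coded message at rate Rc with the private message at rate Rp uses strictly less energy than time sharing fractions f2, f3 at rates R2, R3.) -/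
/-- Key inequality in Lemma 3 (case g1 > g2): superposition coding of the
network-coded message at rate Rc = f2*R2/s with the private message at rate
Rp = f3*R3/s uses strictly less energy than time sharing. -/
theorem stmt_0 (g1 g2 f2 f3 R2 R3 : ℝ)
    (hg : g2 < g1) (hg2 : 0 < g2) (hf2 : 0 < f2) (hf3 : 0 < f3)
    (hR2 : 0 < R2) (hR3 : 0 ≤ R3) :
    (f2 + f3) *
        (((2:ℝ) ^ (f2 * R2 / (f2 + f3) + f3 * R3 / (f2 + f3))
            - (2:ℝ) ^ (f2 * R2 / (f2 + f3))) / g1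
          + ((2:ℝ) ^ (f2 * R2 / (f2 + f3)) - 1) / g2)
      < f2 * ((2:ℝ) ^ R2 - 1) / g2 + f3 * ((2:ℝ) ^ R3 - 1) / g1 := by
  have hs : 0 < f2 + f3 := add_pos hf2 hf3
  have hg1 : 0 < g1 := hg2.trans hg
  set a : ℝ := f2 / (f2 + f3) with ha
  set b : ℝ := f3 / (f2 + f3) with hb
  have hab : a + b = 1 := by rw [ha, hb, ← add_div, div_self hs.ne']
  have ha0 : 0 < a := div_pos hf2 hs
  have hb0 : 0 < b := div_pos hf3 hs
  have hsa : (f2 + f3) * a = f2 := mul_div_cancel₀ f2 hs.ne'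
  have hsb : (f2 + f3) * b = f3 := mul_div_cancel₀ f3 hs.ne'
  have hA : (2:ℝ) ^ (f2 * R2 / (f2 + f3)) = ((2:ℝ) ^ R2) ^ a := by
    rw [← Real.rpow_mul zero_le_two, ha]
    congr 1
    ring
  have hB : (2:ℝ) ^ (f3 * R3 / (f2 + f3)) = ((2:ℝ) ^ R3) ^ b := by
    rw [← Real.rpow_mul zero_le_two, hb]
    congr 1
    ring
  rw [Real.rpow_add two_pos, hA, hB]
  have hA1 : 1 < (2:ℝ) ^ R2 := Real.one_lt_rpow one_lt_two hR2
  have hB0 : 0 < (2:ℝ) ^ R3 := Real.rpow_pos_of_pos two_pos R3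
  generalize (2:ℝ) ^ R2 = A at *
  generalize (2:ℝ) ^ R3 = B at *
  have hmean : A ^ a * B ^ b ≤ a * A + b * B :=
    Real.geom_mean_le_arith_mean2_weighted ha0.le hb0.le (by linarith) hB0.le hab
  have hbern : A ^ a < 1 + a * (A - 1) := by
    simpa using rpow_one_add_lt_one_add_mul_self (s := A - 1) (by linarith)
      (by linarith) ha0 (by linarith)
  have hinv : 0 < g2⁻¹ - g1⁻¹ := sub_pos.mpr (inv_strictAnti₀ hg2 hg)
  have h₁ := mul_le_mul_of_nonneg_right hmean (inv_pos.mpr hg1).le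
  have h₂ := mul_lt_mul_of_pos_right hbern hinv
  have key : (A ^ a * B ^ b - A ^ a) / g1 + (A ^ a - 1) / g2
      < a * (A - 1) / g2 + b * (B - 1) / g1 := by
    simp only [div_eq_mul_inv]
    have hb' : b = 1 - a := by linarith
    generalize A ^ a * B ^ b = C at *
    rw [hb'] at h₁ ⊢
    linarith
  calc _ < (f2 + f3) * (a * (A - 1) / g2 + b * (B - 1) / g1) :=
        mul_lt_mul_of_pos_left key hs
    _ = (f2 + f3) * a * (A - 1) / g2 + (f2 + f3) * b * (B - 1) / g1 := by ring
    _ = _ := by rw [hsa, hsb]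
end

section
/- Let β > 0 and g1, g2 > 0 be real numbers with β·log₂e ≥ 1/g1 + 1/g2, and define h(R) = (2^R − 1/2)·(1/g1 + 1/g2) − β·R for R ≥ 0. Then h attains its minimum over [0, ∞) uniquely at R* = log₂(β·log₂e/(1/g1 + 1/g2)), and the corresponding total power satisfies (2^(R*) − 1/2)·(1/g1 + 1/g2) = β·log₂e − (1/2)·(1/g1 + 1/g2). (This is the water-filling solution (22) for the physical-layer network coding uplink mode.) -/
/-- A stationary point `S` of `R ↦ 2 ^ R * c - β * R` is its unique global minimizer. -/
theorem two_rpow_mul_sub_lt_of_stationary {β c S R : ℝ} (hβ : 0 < β)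
    (hS : (2 : ℝ) ^ S * c = β * (Real.log 2)⁻¹) (hR : R ≠ S) :
    (2 : ℝ) ^ S * c - β * S < (2 : ℝ) ^ R * c - β * R := by
  have hL : 0 < Real.log 2 := Real.log_pos one_lt_two
  have hexp : Real.log 2 * (R - S) + 1 < (2 : ℝ) ^ (R - S) := by
    rw [Real.rpow_def_of_pos two_pos]
    exact Real.add_one_lt_exp (mul_ne_zero hL.ne' (sub_ne_zero.mpr hR))
  have hsplit : (2 : ℝ) ^ R * c = β * (Real.log 2)⁻¹ * (2 : ℝ) ^ (R - S) := by
    rw [← hS, mul_right_comm, ← Real.rpow_add two_pos, add_sub_cancel]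
  have hlt := mul_lt_mul_of_pos_left hexp (mul_pos hβ (inv_pos.mpr hL))
  have hcancel : β * (Real.log 2)⁻¹ * (Real.log 2 * (R - S) + 1)
      = β * (R - S) + β * (Real.log 2)⁻¹ := by
    field_simp
  rw [hsplit, hS]
  linarith

/-- Water-filling solution (22) for the PNC uplink mode: minimizing
h(R) = (2^R − 1/2)·(1/g1 + 1/g2) − β·R over R ≥ 0, the unique minimizer is
R* = log₂(β·log₂e/(1/g1 + 1/g2)) with total power
β·log₂e − (1/2)·(1/g1 + 1/g2). -/
theorem stmt_11 (β g1 g2 : ℝ) (hβ : 0 < β) (hg1 : 0 < g1) (hg2 : 0 < g2)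
    (h : β * (Real.log 2)⁻¹ ≥ 1 / g1 + 1 / g2) :
    (0:ℝ) ≤ Real.logb 2 (β * (Real.log 2)⁻¹ / (1 / g1 + 1 / g2))
    ∧ (∀ R : ℝ, 0 ≤ R → R ≠ Real.logb 2 (β * (Real.log 2)⁻¹ / (1 / g1 + 1 / g2)) →
        ((2:ℝ) ^ (Real.logb 2 (β * (Real.log 2)⁻¹ / (1 / g1 + 1 / g2))) - 1 / 2)
              * (1 / g1 + 1 / g2)
            - β * Real.logb 2 (β * (Real.log 2)⁻¹ / (1 / g1 + 1 / g2))
          < ((2:ℝ) ^ R - 1 / 2) * (1 / g1 + 1 / g2) - β * R)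
    ∧ ((2:ℝ) ^ (Real.logb 2 (β * (Real.log 2)⁻¹ / (1 / g1 + 1 / g2))) - 1 / 2)
          * (1 / g1 + 1 / g2)
        = β * (Real.log 2)⁻¹ - (1 / 2) * (1 / g1 + 1 / g2) := by
  have hc : 0 < 1 / g1 + 1 / g2 := by positivity
  have hb : 0 < β * (Real.log 2)⁻¹ := mul_pos hβ (inv_pos.mpr (Real.log_pos one_lt_two))
  have hS : (2 : ℝ) ^ Real.logb 2 (β * (Real.log 2)⁻¹ / (1 / g1 + 1 / g2)) * (1 / g1 + 1 / g2)
      = β * (Real.log 2)⁻¹ := by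
    rw [Real.rpow_logb two_pos (by norm_num) (div_pos hb hc), div_mul_cancel₀ _ hc.ne']
  refine ⟨Real.logb_nonneg one_lt_two ((one_le_div hc).mpr h), fun R _ hR => ?_, ?_⟩
  · rw [sub_mul, sub_mul]
    linarith [two_rpow_mul_sub_lt_of_stationary hβ hS hR]
  · rw [sub_mul, hS]
end

section
/- Let g1 > g2 > 0 and βc, βp > 0 be real numbers with βp·g1 ≤ βc·g2 and βc·g2·log₂e ≥ 1. Define on [0,∞)² the function F(Rc, Rp) = (2^(Rp) − 1)/g1 + (2^(Rc) − 1)·(1/g2 + (2^(Rp) − 1)/g1) − βc·Rc − βp·Rp. Then F attains its minimum at Rp* = 0 and Rc* = log₂(βc·g2·log₂e); the corresponding private power is 0 and the common power is (2^(Rc*) − 1)/g2 = βc·log₂e − 1/g2. (This is case 1 of Lemma 1: when βp·g1 ≤ βc·g2, the optimal downlink allocation transmits only the network-coded common message, with water-filling power against the weaker gain g2.) -/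
/-- Downlink Lagrangian objective: Pp + Pc − βc·Rc − βp·Rp, with
Pp = (2^Rp − 1)/g1 and Pc = (2^Rc − 1)·(1/g2 + (2^Rp − 1)/g1). -/
noncomputable def Fdl (g1 g2 βc βp Rc Rp : ℝ) : ℝ :=
  ((2:ℝ) ^ Rp - 1) / g1
    + ((2:ℝ) ^ Rc - 1) * (1 / g2 + ((2:ℝ) ^ Rp - 1) / g1)
    - βc * Rc - βp * Rp

/-- Weighted AM-GM between `1` and `2 ^ y`. -/
theorem two_rpow_mul_le {t : ℝ} (y : ℝ) (ht0 : 0 ≤ t) (ht1 : t ≤ 1) :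
    (2:ℝ) ^ (t * y) ≤ 1 - t + t * (2:ℝ) ^ y := by
  have h := Real.geom_mean_le_arith_mean2_weighted (sub_nonneg.2 ht1) ht0 zero_le_one
    (Real.rpow_nonneg zero_le_two y) (by ring)
  rwa [Real.one_rpow, one_mul, mul_one, ← Real.rpow_mul zero_le_two, mul_comm y t] at h

/-- Tangent-line bound for `2 ^ x` at the point where it takes the value `s`. -/
theorem mul_sub_logb_le_two_rpow_sub {s : ℝ} (x : ℝ) (hs : 0 < s) :
    s * Real.log 2 * (x - Real.logb 2 s) ≤ (2:ℝ) ^ x - s := by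
  have hx : (0:ℝ) < 2 ^ x := Real.rpow_pos_of_pos two_pos x
  have h := Real.log_le_sub_one_of_pos (div_pos hx hs)
  rw [Real.log_div hx.ne' hs.ne', Real.log_rpow two_pos] at h
  have hlog : Real.logb 2 s * Real.log 2 = Real.log s :=
    div_mul_cancel₀ _ (Real.log_pos one_lt_two).ne'
  calc s * Real.log 2 * (x - Real.logb 2 s)
      = s * (x * Real.log 2 - Real.log s) := by rw [← hlog]; ring
    _ ≤ s * ((2:ℝ) ^ x / s - 1) := mul_le_mul_of_nonneg_left h hs.le
    _ = (2:ℝ) ^ x - s := by field_simp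

/-- Case 1 of Lemma 1: when βp·g1 ≤ βc·g2 (and βc·g2·log₂e ≥ 1), the optimal
downlink allocation transmits only the common message at
Rc* = log₂(βc·g2·log₂e), with water-filling power βc·log₂e − 1/g2, and zero
private power. -/
theorem stmt_13 (g1 g2 βc βp : ℝ)
    (hg : g2 < g1) (hg2 : 0 < g2) (hβc : 0 < βc) (hβp : 0 < βp)
    (hcase : βp * g1 ≤ βc * g2)
    (hwf : βc * g2 * (Real.log 2)⁻¹ ≥ 1) :
    (0:ℝ) ≤ Real.logb 2 (βc * g2 * (Real.log 2)⁻¹)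
    ∧ (∀ Rc Rp : ℝ, 0 ≤ Rc → 0 ≤ Rp →
        Fdl g1 g2 βc βp (Real.logb 2 (βc * g2 * (Real.log 2)⁻¹)) 0
          ≤ Fdl g1 g2 βc βp Rc Rp)
    ∧ ((2:ℝ) ^ ((0:ℝ)) - 1) / g1 = 0
    ∧ ((2:ℝ) ^ (Real.logb 2 (βc * g2 * (Real.log 2)⁻¹)) - 1) / g2
        = βc * (Real.log 2)⁻¹ - 1 / g2 := by
  have hL : 0 < Real.log 2 := Real.log_pos one_lt_two
  have hg1 : 0 < g1 := hg2.trans hg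
  set s := βc * g2 * (Real.log 2)⁻¹ with hs_def
  have hs : 0 < s := zero_lt_one.trans_le hwf
  have hpow : (2:ℝ) ^ Real.logb 2 s = s :=
    Real.rpow_logb two_pos (by norm_num) hs
  have hsL : s * Real.log 2 = βc * g2 := by
    rw [hs_def]
    field_simp
  refine ⟨Real.logb_nonneg one_lt_two hwf, fun Rc Rp _ hRp => ?_, by simp, ?_⟩
  · have hamgm := two_rpow_mul_le Rp (div_pos hg2 hg1).le ((div_le_one hg1).2 hg.le)
    have htan := mul_sub_logb_le_two_rpow_sub (Rc + g2 / g1 * Rp) hs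
    rw [Real.rpow_add two_pos, hsL] at htan
    have hx : (0:ℝ) < 2 ^ Rc := Real.rpow_pos_of_pos two_pos Rc
    have hmul := mul_le_mul_of_nonneg_left hamgm hx.le
    have hβ : βp * Rp ≤ βc * (g2 / g1) * Rp := by
      refine mul_le_mul_of_nonneg_right ?_ hRp
      rw [← mul_div_assoc]
      exact (le_div_iff₀ hg1).2 hcase
    have hdiff : Fdl g1 g2 βc βp Rc Rp - Fdl g1 g2 βc βp (Real.logb 2 s) 0
        = ((2:ℝ) ^ Rc * (1 - g2 / g1 + g2 / g1 * (2:ℝ) ^ Rp) - s) / g2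
          - βc * (Rc - Real.logb 2 s) - βp * Rp := by
      simp only [Fdl, hpow, Real.rpow_zero]
      field_simp
      ring
    have hdiv : βc * (Rc + g2 / g1 * Rp - Real.logb 2 s)
        ≤ ((2:ℝ) ^ Rc * (1 - g2 / g1 + g2 / g1 * (2:ℝ) ^ Rp) - s) / g2 := by
      rw [le_div_iff₀ hg2]
      linarith
    linarith
  · rw [hpow, hs_def]
    field_simp
end

section
/- Let g1 > g2 > 0 and βc, βp > 0 be real numbers with (βc − βp)·log₂e ≤ (g1 − g2)/(g1·g2) and βp·g1·log₂e ≥ 1. Define on [0,∞)² the function F(Rc, Rp) = (2^(Rp) − 1)/g1 + (2^(Rc) − 1)·(1/g2 + (2^(Rp) − 1)/g1) − βc·Rc − βp·Rp. Then F attains its minimum at Rc* = 0 and Rp* = log₂(βp·g1·log₂e); the corresponding common power is 0 and the private power is (2^(Rp*) − 1)/g1 = βp·log₂e − 1/g1. (This is case 2 of Lemma 1: the optimal downlink allocation transmits only the private message, with water-filling power against the gain g1.) -/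
/-- Writing `b`, `a` for `βc / log 2`, `βp / log 2`, the objective splits into a function of the
total rate `Rc + Rp` and a function of `Rc`. -/
theorem Fdl_eq {g1 g2 : ℝ} (b a Rc Rp : ℝ) (hg1 : g1 ≠ 0) (hg2 : g2 ≠ 0) :
    Fdl g1 g2 (b * Real.log 2) (a * Real.log 2) Rc Rp =
      ((2:ℝ) ^ (Rc + Rp) / g1 - a * (Real.log 2 * (Rc + Rp)) - 1 / g1)
        + ((g1 - g2) / (g1 * g2) * ((2:ℝ) ^ Rc - 1) - (b - a) * (Real.log 2 * Rc)) := by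
  rw [Fdl, Real.rpow_add two_pos]
  field_simp
  ring

/-- The function `z ↦ z / g - a * log z` is minimal at `z = a * g`. -/
theorem div_sub_mul_log_min {g a z : ℝ} (hg : 0 < g) (ha : 0 < a) (hz : 0 < z) :
    a * g / g - a * Real.log (a * g) ≤ z / g - a * Real.log z := by
  have h := Real.log_le_sub_one_of_pos (div_pos hz (mul_pos ha hg))
  rw [Real.log_div hz.ne' (mul_pos ha hg).ne'] at h
  have h2 := mul_le_mul_of_nonneg_left h ha.le
  have h3 : a * (z / (a * g) - 1) = z / g - a * g / g := by field_simp
  linarith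

/-- Case 2 of Lemma 1: when (βc − βp)·log₂e ≤ (g1 − g2)/(g1·g2) (and
βp·g1·log₂e ≥ 1), the optimal downlink allocation transmits only the private
message at Rp* = log₂(βp·g1·log₂e) with water-filling power βp·log₂e − 1/g1,
and zero common power. -/
theorem stmt_14 (g1 g2 βc βp : ℝ)
    (hg : g2 < g1) (hg2 : 0 < g2) (hβc : 0 < βc) (hβp : 0 < βp)
    (hcase : (βc - βp) * (Real.log 2)⁻¹ ≤ (g1 - g2) / (g1 * g2))
    (hwf : βp * g1 * (Real.log 2)⁻¹ ≥ 1) :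
    (0:ℝ) ≤ Real.logb 2 (βp * g1 * (Real.log 2)⁻¹)
    ∧ (∀ Rc Rp : ℝ, 0 ≤ Rc → 0 ≤ Rp →
        Fdl g1 g2 βc βp 0 (Real.logb 2 (βp * g1 * (Real.log 2)⁻¹))
          ≤ Fdl g1 g2 βc βp Rc Rp)
    ∧ ((2:ℝ) ^ ((0:ℝ)) - 1) * (1 / g2
        + ((2:ℝ) ^ (Real.logb 2 (βp * g1 * (Real.log 2)⁻¹)) - 1) / g1) = 0
    ∧ ((2:ℝ) ^ (Real.logb 2 (βp * g1 * (Real.log 2)⁻¹)) - 1) / g1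
        = βp * (Real.log 2)⁻¹ - 1 / g1 := by
  have hL : 0 < Real.log 2 := Real.log_pos one_lt_two
  have hg1 : 0 < g1 := hg2.trans hg
  obtain ⟨a, rfl⟩ : ∃ a, βp = a * Real.log 2 := ⟨βp / Real.log 2, by field_simp⟩
  obtain ⟨b, rfl⟩ : ∃ b, βc = b * Real.log 2 := ⟨βc / Real.log 2, by field_simp⟩
  have ha : 0 < a := pos_of_mul_pos_left hβp hL.le
  have hw : a * Real.log 2 * g1 * (Real.log 2)⁻¹ = a * g1 := by field_simp
  have hab : (b * Real.log 2 - a * Real.log 2) * (Real.log 2)⁻¹ = b - a := by field_simp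
  rw [hw] at hwf ⊢
  rw [hab] at hcase
  have hpow : (2:ℝ) ^ Real.logb 2 (a * g1) = a * g1 :=
    Real.rpow_logb two_pos (by norm_num) (mul_pos ha hg1)
  refine ⟨Real.logb_nonneg one_lt_two hwf, fun Rc Rp hRc _ => ?_, by simp, ?_⟩
  · have htotal := div_sub_mul_log_min hg1 ha (Real.rpow_pos_of_pos two_pos (Rc + Rp))
    have hlog : Real.log 2 * Real.logb 2 (a * g1) = Real.log (a * g1) := by
      rw [Real.logb]; field_simp
    have hcommon := Real.log_le_sub_one_of_pos (Real.rpow_pos_of_pos two_pos Rc)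
    rw [Real.log_rpow two_pos, mul_comm _ (Real.log 2)] at htotal hcommon
    have hd : 0 ≤ (g1 - g2) / (g1 * g2) :=
      div_nonneg (sub_nonneg.2 hg.le) (mul_pos hg1 hg2).le
    have h1 := mul_le_mul_of_nonneg_right hcase (mul_nonneg hL.le hRc)
    have h2 := mul_le_mul_of_nonneg_left hcommon hd
    rw [Fdl_eq b a _ _ hg1.ne' hg2.ne', Fdl_eq b a _ _ hg1.ne' hg2.ne', zero_add, hpow, hlog,
      Real.rpow_zero]
    linarith
  · rw [hpow]
    field_simp
end

section
/- Let g1 > g2 > 0 and βc, βp > 0 be real numbers with βp·g1 > βc·g2 and (βc − βp)·log₂e > (g1 − g2)/(g1·g2) (so in particular βc > βp). Define on [0,∞)² the function F(Rc, Rp) = (2^(Rp) − 1)/g1 + (2^(Rc) − 1)·(1/g2 + (2^(Rp) − 1)/g1) − βc·Rc − βp·Rp. Then F attains its minimum at the interior point with 2^(Rc*) = (βc − βp)·log₂e·g1·g2/(g1 − g2) and 2^(Rp*) = βp·(g1 − g2)/((βc − βp)·g2); at this point the private power is Pp = (βp·g1 − βc·g2)/((βc − βp)·g1·g2) and the total power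 satisfies Pc + Pp = βc·log₂e − 1/g2. (This is the interior case 3 of Lemma 1, characterizing the optimal simultaneous transmission of the network-coded common message and the private message.) -/
/-- Tangent-line bound: `R ↦ k * 2 ^ R - b * R` is minimized where its derivative vanishes. -/
theorem mul_two_rpow_sub_mul_le {k b R₀ : ℝ} (hk : 0 ≤ k)
    (hb : k * (2:ℝ) ^ R₀ * Real.log 2 = b) (R : ℝ) :
    k * (2:ℝ) ^ R₀ - b * R₀ ≤ k * (2:ℝ) ^ R - b * R := by
  have hpow : (2:ℝ) ^ R = (2:ℝ) ^ R₀ * Real.exp (Real.log 2 * (R - R₀)) := by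
    rw [← Real.rpow_def_of_pos two_pos, ← Real.rpow_add two_pos, add_sub_cancel]
  have hpos : 0 ≤ k * (2:ℝ) ^ R₀ := by positivity
  have htangent := mul_le_mul_of_nonneg_left
    (Real.add_one_le_exp (Real.log 2 * (R - R₀))) hpos
  rw [hpow, ← hb]
  linarith

/-- The objective separates in the variables `Rc` and `Rc + Rp`. -/
theorem Fdl_eq_separated (g1 g2 βc βp Rc Rp : ℝ) :
    Fdl g1 g2 βc βp Rc Rp =
      ((1 / g2 - 1 / g1) * (2:ℝ) ^ Rc - (βc - βp) * Rc)
        + (1 / g1 * (2:ℝ) ^ (Rc + Rp) - βp * (Rc + Rp)) - 1 / g2 := by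
  rw [Fdl, Real.rpow_add two_pos]
  ring

/-- Interior case 3 of Lemma 1: when βp·g1 > βc·g2 and
(βc − βp)·log₂e > (g1 − g2)/(g1·g2), the minimum is at the interior point
with 2^Rc* = (βc − βp)·log₂e·g1·g2/(g1 − g2) and
2^Rp* = βp·(g1 − g2)/((βc − βp)·g2); the private power is
(βp·g1 − βc·g2)/((βc − βp)·g1·g2) and the total power is βc·log₂e − 1/g2. -/
theorem stmt_15 (g1 g2 βc βp : ℝ)
    (hg : g2 < g1) (hg2 : 0 < g2) (hβc : 0 < βc) (hβp : 0 < βp)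
    (hcase1 : βp * g1 > βc * g2)
    (hcase2 : (βc - βp) * (Real.log 2)⁻¹ > (g1 - g2) / (g1 * g2)) :
    βc > βp
    ∧ (0:ℝ) < Real.logb 2 ((βc - βp) * (Real.log 2)⁻¹ * g1 * g2 / (g1 - g2))
    ∧ (0:ℝ) < Real.logb 2 (βp * (g1 - g2) / ((βc - βp) * g2))
    ∧ (∀ Rc Rp : ℝ, 0 ≤ Rc → 0 ≤ Rp →
        Fdl g1 g2 βc βp
            (Real.logb 2 ((βc - βp) * (Real.log 2)⁻¹ * g1 * g2 / (g1 - g2)))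
            (Real.logb 2 (βp * (g1 - g2) / ((βc - βp) * g2)))
          ≤ Fdl g1 g2 βc βp Rc Rp)
    ∧ ((2:ℝ) ^ (Real.logb 2 (βp * (g1 - g2) / ((βc - βp) * g2))) - 1) / g1
        = (βp * g1 - βc * g2) / ((βc - βp) * g1 * g2)
    ∧ ((2:ℝ) ^ (Real.logb 2 ((βc - βp) * (Real.log 2)⁻¹ * g1 * g2 / (g1 - g2))) - 1)
          * (1 / g2
            + ((2:ℝ) ^ (Real.logb 2 (βp * (g1 - g2) / ((βc - βp) * g2))) - 1) / g1)
        + ((2:ℝ) ^ (Real.logb 2 (βp * (g1 - g2) / ((βc - βp) * g2))) - 1) / g1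
        = βc * (Real.log 2)⁻¹ - 1 / g2 := by
  have hg1 : 0 < g1 := hg2.trans hg
  have hd : 0 < g1 - g2 := sub_pos.2 hg
  have hlog : 0 < Real.log 2 := Real.log_pos one_lt_two
  have hβ : 0 < βc - βp := by
    have h : 0 < (βc - βp) * (Real.log 2)⁻¹ := lt_trans (by positivity) hcase2
    exact pos_of_mul_pos_left h (by positivity)
  have hX : 1 < (βc - βp) * (Real.log 2)⁻¹ * g1 * g2 / (g1 - g2) := by
    rw [gt_iff_lt, div_lt_iff₀ (by positivity)] at hcase2
    rw [one_lt_div hd]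
    linarith
  have hY : 1 < βp * (g1 - g2) / ((βc - βp) * g2) := by
    rw [one_lt_div (by positivity)]
    linarith
  have hXpow := Real.rpow_logb two_pos (by norm_num) (one_pos.trans hX)
  have hYpow := Real.rpow_logb two_pos (by norm_num) (one_pos.trans hY)
  refine ⟨sub_pos.1 hβ, Real.logb_pos one_lt_two hX, Real.logb_pos one_lt_two hY, ?_, ?_, ?_⟩
  · intro Rc Rp _ _
    rw [Fdl_eq_separated, Fdl_eq_separated]
    gcongr ?_ + ?_ - _
    · refine mul_two_rpow_sub_mul_le (sub_nonneg.2 ?_) ?_ Rc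
      · exact one_div_le_one_div_of_le hg2 hg.le
      · rw [hXpow]
        field_simp
    · refine mul_two_rpow_sub_mul_le (by positivity) ?_ (Rc + Rp)
      rw [Real.rpow_add two_pos, hXpow, hYpow]
      field_simp
  · rw [hYpow]
    field_simp
    ring
  · rw [hXpow, hYpow]
    field_simp
    ring
end

section
/- Let g1 > g2 > 0 and β1, β2 > 0 be real numbers with (β2 − β1)·log₂e ≤ (g1 − g2)/(g1·g2) and β1·g1·log₂e ≥ 1. Define on [0,∞)² the function G(R1, R2) = (2^(R1) − 1)·2^(R2)/g1 + (2^(R2) − 1)/g2 − β1·R1 − β2·R2. Then G attains its minimum at R2* = 0 and R1* = log₂(β1·g1·log₂e); the corresponding power of user 2 is 0 and the power of user 1 is (2^(R1*) − 1)/g1 = β1·log₂e − 1/g1. (This is the corner case of Lemma 2: on the multi-access uplink only the user with the stronger gain g1 transmits, with water-filling power.) -/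
/-- Multi-access uplink Lagrangian objective: P1 + P2 − β1·R1 − β2·R2, with
P1 = (2^R1 − 1)·2^R2/g1 and P2 = (2^R2 − 1)/g2. -/
noncomputable def Gul (g1 g2 β1 β2 R1 R2 : ℝ) : ℝ :=
  ((2:ℝ) ^ R1 - 1) * (2:ℝ) ^ R2 / g1 + ((2:ℝ) ^ R2 - 1) / g2
    - β1 * R1 - β2 * R2

/-- The graph of `2 ^ x` lies above each of its tangent lines. -/
theorem two_rpow_tangent_le (a b : ℝ) :
    (2:ℝ) ^ a * (1 + (b - a) * Real.log 2) ≤ (2:ℝ) ^ b := by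
  have h : (2:ℝ) ^ b = (2:ℝ) ^ a * (2:ℝ) ^ (b - a) := by
    rw [← Real.rpow_add two_pos]
    ring_nf
  rw [h]
  gcongr
  rw [Real.rpow_def_of_pos two_pos]
  linarith [Real.add_one_le_exp (Real.log 2 * (b - a))]

/-- The Lagrangian separates in the sum rate `R1 + R2` and the rate `R2`. -/
theorem Gul_eq_sum_rate (g1 g2 β1 β2 R1 R2 : ℝ) :
    Gul g1 g2 β1 β2 R1 R2 = ((2:ℝ) ^ (R1 + R2) / g1 - β1 * (R1 + R2))
      + ((1 / g2 - 1 / g1) * (2:ℝ) ^ R2 - (β2 - β1) * R2) - 1 / g2 := by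
  rw [Gul, Real.rpow_add two_pos]
  ring

/-- Corner case of Lemma 2: when (β2 − β1)·log₂e ≤ (g1 − g2)/(g1·g2) (and
β1·g1·log₂e ≥ 1), only the user with the stronger gain g1 transmits, at
R1* = log₂(β1·g1·log₂e) with water-filling power β1·log₂e − 1/g1. -/
theorem stmt_16 (g1 g2 β1 β2 : ℝ)
    (hg : g2 < g1) (hg2 : 0 < g2) (hβ1 : 0 < β1) (hβ2 : 0 < β2)
    (hcase : (β2 - β1) * (Real.log 2)⁻¹ ≤ (g1 - g2) / (g1 * g2))
    (hwf : β1 * g1 * (Real.log 2)⁻¹ ≥ 1) :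
    (0:ℝ) ≤ Real.logb 2 (β1 * g1 * (Real.log 2)⁻¹)
    ∧ (∀ R1 R2 : ℝ, 0 ≤ R1 → 0 ≤ R2 →
        Gul g1 g2 β1 β2 (Real.logb 2 (β1 * g1 * (Real.log 2)⁻¹)) 0
          ≤ Gul g1 g2 β1 β2 R1 R2)
    ∧ ((2:ℝ) ^ ((0:ℝ)) - 1) / g2 = 0
    ∧ ((2:ℝ) ^ (Real.logb 2 (β1 * g1 * (Real.log 2)⁻¹)) - 1) / g1
        = β1 * (Real.log 2)⁻¹ - 1 / g1 := by
  have hg1 : 0 < g1 := hg2.trans hg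
  have hlog : 0 < Real.log 2 := Real.log_pos one_lt_two
  have hpow : (2:ℝ) ^ Real.logb 2 (β1 * g1 * (Real.log 2)⁻¹) = β1 * g1 * (Real.log 2)⁻¹ :=
    Real.rpow_logb two_pos (by norm_num) (by positivity)
  refine ⟨Real.logb_nonneg one_lt_two hwf, fun R1 R2 _ hR2 => ?_, by simp, ?_⟩
  · rw [Gul_eq_sum_rate, Gul_eq_sum_rate]
    set r := Real.logb 2 (β1 * g1 * (Real.log 2)⁻¹)
    have hc : (g1 - g2) / (g1 * g2) = 1 / g2 - 1 / g1 := by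
      field_simp
    have hc_nonneg : 0 ≤ 1 / g2 - 1 / g1 :=
      sub_nonneg.2 (one_div_le_one_div_of_le hg2 hg.le)
    have hslope : β2 - β1 ≤ (1 / g2 - 1 / g1) * Real.log 2 := by
      rwa [hc, ← div_eq_mul_inv, div_le_iff₀ hlog] at hcase
    have hsum : (2:ℝ) ^ r / g1 + β1 * (R1 + R2 - r) ≤ (2:ℝ) ^ (R1 + R2) / g1 := by
      calc (2:ℝ) ^ r / g1 + β1 * (R1 + R2 - r)
          = (2:ℝ) ^ r * (1 + (R1 + R2 - r) * Real.log 2) / g1 := by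
            rw [hpow]
            field_simp
        _ ≤ (2:ℝ) ^ (R1 + R2) / g1 := by
            gcongr
            exact two_rpow_tangent_le r (R1 + R2)
    have htwo : 1 + R2 * Real.log 2 ≤ (2:ℝ) ^ R2 := by
      simpa using two_rpow_tangent_le 0 R2
    have hexp := mul_le_mul_of_nonneg_left htwo hc_nonneg
    have hlin := mul_le_mul_of_nonneg_right hslope hR2
    rw [Real.rpow_zero, add_zero]
    linarith
  · rw [hpow]
    field_simp
end

section
/- Let g1 > g2 > 0 and β1, β2 > 0 be real numbers with β1·g1 ≤ β2·g2 and β2·g2·log₂e ≥ 1. Define on [0,∞)² the function G(R1, R2) = (2^(R1) − 1)·2^(R2)/g1 + (2^(R2) − 1)/g2 − β1·R1 − β2·R2. Then G attains its minimum at R1* = 0 and R2* = log₂(β2·g2·log₂e); the corresponding power of user 1 is 0 and the power of user 2 is (2^(R2*) − 1)/g2 = β2·log₂e − 1/g2. (This is the corner case of Lemma 2 in which only the user with the weaker gain g2 transmits, with water-filling power.) -/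
/-- Bernoulli's inequality for powers of two with an exponent scaled by `r ∈ [0, 1]`. -/
lemma two_rpow_mul_le_s17 (r x : ℝ) (hr0 : 0 ≤ r) (hr1 : r ≤ 1) :
    (2:ℝ) ^ (r * x) ≤ 1 + r * ((2:ℝ) ^ x - 1) := by
  have hx : (0:ℝ) < (2:ℝ) ^ x := Real.rpow_pos_of_pos two_pos x
  have h := rpow_one_add_le_one_add_mul_self (s := (2:ℝ) ^ x - 1) (by linarith) hr0 hr1
  rwa [add_sub_cancel, ← Real.rpow_mul two_pos.le, mul_comm x r] at h

/-- Corner case of Lemma 2: when β1·g1 ≤ β2·g2 (and β2·g2·log₂e ≥ 1), only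
the user with the weaker gain g2 transmits, at R2* = log₂(β2·g2·log₂e) with
water-filling power β2·log₂e − 1/g2. -/
theorem stmt_17 (g1 g2 β1 β2 : ℝ)
    (hg : g2 < g1) (hg2 : 0 < g2) (hβ1 : 0 < β1) (hβ2 : 0 < β2)
    (hcase : β1 * g1 ≤ β2 * g2)
    (hwf : β2 * g2 * (Real.log 2)⁻¹ ≥ 1) :
    (0:ℝ) ≤ Real.logb 2 (β2 * g2 * (Real.log 2)⁻¹)
    ∧ (∀ R1 R2 : ℝ, 0 ≤ R1 → 0 ≤ R2 →
        Gul g1 g2 β1 β2 0 (Real.logb 2 (β2 * g2 * (Real.log 2)⁻¹))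
          ≤ Gul g1 g2 β1 β2 R1 R2)
    ∧ ((2:ℝ) ^ ((0:ℝ)) - 1)
          * (2:ℝ) ^ (Real.logb 2 (β2 * g2 * (Real.log 2)⁻¹)) / g1 = 0
    ∧ ((2:ℝ) ^ (Real.logb 2 (β2 * g2 * (Real.log 2)⁻¹)) - 1) / g2
        = β2 * (Real.log 2)⁻¹ - 1 / g2 := by
  have hL : 0 < Real.log 2 := Real.log_pos (by norm_num)
  have hg1 : 0 < g1 := hg2.trans hg
  have hY : 0 < β2 * g2 * (Real.log 2)⁻¹ := by positivity
  have hpow : (2:ℝ) ^ Real.logb 2 (β2 * g2 * (Real.log 2)⁻¹) = β2 * g2 * (Real.log 2)⁻¹ :=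
    Real.rpow_logb (by norm_num) (by norm_num) hY
  refine ⟨Real.logb_nonneg (by norm_num) hwf, ?_, by simp, ?_⟩
  · intro R1 R2 hR1 hR2
    set w := Real.logb 2 (β2 * g2 * (Real.log 2)⁻¹) with hw
    have hbern := two_rpow_mul_le_s17 (g2 / g1) R1 (by positivity) ((div_le_one hg1).2 hg.le)
    have htangent : 1 + Real.log 2 * (g2 / g1 * R1 + R2 - w)
        ≤ (1 + g2 / g1 * ((2:ℝ) ^ R1 - 1)) * (2:ℝ) ^ R2 / (β2 * g2 * (Real.log 2)⁻¹) := by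
      calc 1 + Real.log 2 * (g2 / g1 * R1 + R2 - w)
          ≤ (2:ℝ) ^ (g2 / g1 * R1 + R2 - w) := by
            rw [Real.rpow_def_of_pos two_pos, add_comm]
            exact Real.add_one_le_exp _
        _ = (2:ℝ) ^ (g2 / g1 * R1) * (2:ℝ) ^ R2 / (β2 * g2 * (Real.log 2)⁻¹) := by
            rw [Real.rpow_sub two_pos, Real.rpow_add two_pos, hpow]
        _ ≤ _ := by gcongr
    have hscaled := mul_le_mul_of_nonneg_left htangent
      (show 0 ≤ β2 * (Real.log 2)⁻¹ by positivity)
    have hleft : β2 * (Real.log 2)⁻¹ * (1 + Real.log 2 * (g2 / g1 * R1 + R2 - w))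
        = β2 * (Real.log 2)⁻¹ + β2 * g2 / g1 * R1 + β2 * R2 - β2 * w := by
      field_simp
      ring
    have hright : β2 * (Real.log 2)⁻¹ * ((1 + g2 / g1 * ((2:ℝ) ^ R1 - 1)) * (2:ℝ) ^ R2
          / (β2 * g2 * (Real.log 2)⁻¹))
        = ((2:ℝ) ^ R1 - 1) * (2:ℝ) ^ R2 / g1 + (2:ℝ) ^ R2 / g2 := by
      field_simp
      ring
    have hR1_term : β1 * R1 ≤ β2 * g2 / g1 * R1 :=
      mul_le_mul_of_nonneg_right ((le_div_iff₀ hg1).2 hcase) hR1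
    have hstar : β2 * g2 * (Real.log 2)⁻¹ / g2 = β2 * (Real.log 2)⁻¹ := by
      field_simp
    rw [hleft, hright] at hscaled
    simp only [Gul, hpow, Real.rpow_zero, sub_self, zero_mul, zero_div, mul_zero, sub_div, hstar]
    simp only [sub_div, sub_mul] at hscaled ⊢
    linarith
  · rw [hpow]
    field_simp
end

section
/- Let g1 > g2 > 0 and β1, β2 > 0 be real numbers with β1·g1 > β2·g2 and (β2 − β1)·log₂e > (g1 − g2)/(g1·g2) (so in particular β2 > β1). Define on [0,∞)² the function G(R1, R2) = (2^(R1) − 1)·2^(R2)/g1 + (2^(R2) − 1)/g2 − β1·R1 − β2·R2. Then G attains its minimum at the interior point with 2^(R2*) = (β2 − β1)·log₂e·g1·g2/(g1 − g2) and 2^(R1*)·2^(R2*) = β1·g1·log₂e; at this point the powers are P1 = (β1·g1 − β2·g2)·log₂e/(g1 − g2) and P2 = (β2 − β1)·g1·log₂e/(g1 − g2) − 1/g2. (This is the interior case of Lemma 2, characterizing the optimal simultaneous multi-access transmission of both users.) -/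
/-- The function `x ↦ a * 2 ^ x - b * x` is minimized at its critical point. -/
lemma mul_two_rpow_sub_mul_le_s18 {a b x₀ : ℝ} (ha : 0 ≤ a)
    (hx₀ : a * (2:ℝ) ^ x₀ = b * (Real.log 2)⁻¹) (x : ℝ) :
    a * (2:ℝ) ^ x₀ - b * x₀ ≤ a * (2:ℝ) ^ x - b * x := by
  have hlog : 0 < Real.log 2 := Real.log_pos one_lt_two
  have hb : b = a * (2:ℝ) ^ x₀ * Real.log 2 := by rw [hx₀]; field_simp
  have hsplit : (2:ℝ) ^ x = (2:ℝ) ^ x₀ * (2:ℝ) ^ (x - x₀) := by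
    rw [← Real.rpow_add two_pos]; ring_nf
  have htangent : Real.log 2 * (x - x₀) + 1 ≤ (2:ℝ) ^ (x - x₀) := by
    rw [Real.rpow_def_of_pos two_pos]
    exact Real.add_one_le_exp _
  have h := mul_le_mul_of_nonneg_left htangent (by positivity : 0 ≤ a * (2:ℝ) ^ x₀)
  rw [hsplit, hb]
  linarith

/-- In the variables `R1 + R2` and `R2` the objective separates. -/
lemma Gul_eq_separated (g1 g2 β1 β2 R1 R2 : ℝ) :
    Gul g1 g2 β1 β2 R1 R2 =
      (g1⁻¹ * (2:ℝ) ^ (R1 + R2) - β1 * (R1 + R2))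
        + ((g2⁻¹ - g1⁻¹) * (2:ℝ) ^ R2 - (β2 - β1) * R2) - g2⁻¹ := by
  rw [Gul, Real.rpow_add two_pos]
  ring

/-- Interior case of Lemma 2: when β1·g1 > β2·g2 and
(β2 − β1)·log₂e > (g1 − g2)/(g1·g2), the minimum is at the interior point
with 2^R2* = (β2 − β1)·log₂e·g1·g2/(g1 − g2) and 2^R1*·2^R2* = β1·g1·log₂e;
the powers are P1 = (β1·g1 − β2·g2)·log₂e/(g1 − g2) and
P2 = (β2 − β1)·g1·log₂e/(g1 − g2) − 1/g2. -/
theorem stmt_18 (g1 g2 β1 β2 : ℝ)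
    (hg : g2 < g1) (hg2 : 0 < g2) (hβ1 : 0 < β1) (hβ2 : 0 < β2)
    (hcase1 : β1 * g1 > β2 * g2)
    (hcase2 : (β2 - β1) * (Real.log 2)⁻¹ > (g1 - g2) / (g1 * g2)) :
    β2 > β1
    ∧ (0:ℝ) < Real.logb 2 ((β2 - β1) * (Real.log 2)⁻¹ * g1 * g2 / (g1 - g2))
    ∧ (0:ℝ) < Real.logb 2 (β1 * g1 * (Real.log 2)⁻¹)
        - Real.logb 2 ((β2 - β1) * (Real.log 2)⁻¹ * g1 * g2 / (g1 - g2))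
    ∧ (2:ℝ) ^ (Real.logb 2 (β1 * g1 * (Real.log 2)⁻¹)
          - Real.logb 2 ((β2 - β1) * (Real.log 2)⁻¹ * g1 * g2 / (g1 - g2)))
        * (2:ℝ) ^ (Real.logb 2 ((β2 - β1) * (Real.log 2)⁻¹ * g1 * g2 / (g1 - g2)))
        = β1 * g1 * (Real.log 2)⁻¹
    ∧ (∀ R1 R2 : ℝ, 0 ≤ R1 → 0 ≤ R2 →
        Gul g1 g2 β1 β2
            (Real.logb 2 (β1 * g1 * (Real.log 2)⁻¹)
              - Real.logb 2 ((β2 - β1) * (Real.log 2)⁻¹ * g1 * g2 / (g1 - g2)))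
            (Real.logb 2 ((β2 - β1) * (Real.log 2)⁻¹ * g1 * g2 / (g1 - g2)))
          ≤ Gul g1 g2 β1 β2 R1 R2)
    ∧ ((2:ℝ) ^ (Real.logb 2 (β1 * g1 * (Real.log 2)⁻¹)
            - Real.logb 2 ((β2 - β1) * (Real.log 2)⁻¹ * g1 * g2 / (g1 - g2))) - 1)
          * (2:ℝ) ^ (Real.logb 2 ((β2 - β1) * (Real.log 2)⁻¹ * g1 * g2 / (g1 - g2)))
          / g1
        = (β1 * g1 - β2 * g2) * (Real.log 2)⁻¹ / (g1 - g2)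
    ∧ ((2:ℝ) ^ (Real.logb 2 ((β2 - β1) * (Real.log 2)⁻¹ * g1 * g2 / (g1 - g2))) - 1)
          / g2
        = (β2 - β1) * g1 * (Real.log 2)⁻¹ / (g1 - g2) - 1 / g2 := by
  have hg1 : 0 < g1 := hg2.trans hg
  have hd : 0 < g1 - g2 := sub_pos.2 hg
  have hlog : 0 < Real.log 2 := Real.log_pos one_lt_two
  have hlog' : 0 < (Real.log 2)⁻¹ := inv_pos.2 hlog
  have hβ : β1 < β2 := by
    have h : 0 < (β2 - β1) * (Real.log 2)⁻¹ := lt_trans (by positivity) hcase2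
    exact sub_pos.1 (pos_of_mul_pos_left h hlog'.le)
  have hB1 : 1 < (β2 - β1) * (Real.log 2)⁻¹ * g1 * g2 / (g1 - g2) := by
    rw [gt_iff_lt, div_lt_iff₀ (by positivity)] at hcase2
    rw [lt_div_iff₀ hd]
    linarith
  have hBA : (β2 - β1) * (Real.log 2)⁻¹ * g1 * g2 / (g1 - g2)
      < β1 * g1 * (Real.log 2)⁻¹ := by
    rw [div_lt_iff₀ hd]
    have h := mul_lt_mul_of_pos_left hcase1 (mul_pos hlog' hg1)
    linarith
  have hA : (2:ℝ) ^ Real.logb 2 (β1 * g1 * (Real.log 2)⁻¹) = β1 * g1 * (Real.log 2)⁻¹ :=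
    Real.rpow_logb two_pos (by norm_num) (by positivity)
  have hB := Real.rpow_logb two_pos (by norm_num) (one_pos.trans hB1)
  have hlt := Real.logb_lt_logb one_lt_two (one_pos.trans hB1) hBA
  have hpos := Real.logb_pos one_lt_two hB1
  generalize Real.logb 2 (β1 * g1 * (Real.log 2)⁻¹) = S at *
  generalize Real.logb 2 ((β2 - β1) * (Real.log 2)⁻¹ * g1 * g2 / (g1 - g2)) = T at *
  have hprod : (2:ℝ) ^ (S - T) * (2:ℝ) ^ T = β1 * g1 * (Real.log 2)⁻¹ := by
    rw [← Real.rpow_add two_pos, sub_add_cancel, hA]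
  refine ⟨hβ, hpos, sub_pos.2 hlt, hprod, fun R1 R2 _ _ => ?_, ?_, ?_⟩
  · have hS : g1⁻¹ * (2:ℝ) ^ S = β1 * (Real.log 2)⁻¹ := by rw [hA]; field_simp
    have hT : (g2⁻¹ - g1⁻¹) * (2:ℝ) ^ T = (β2 - β1) * (Real.log 2)⁻¹ := by
      rw [hB]; field_simp
    have h1 := mul_two_rpow_sub_mul_le_s18 (inv_nonneg.2 hg1.le) hS (R1 + R2)
    have h2 := mul_two_rpow_sub_mul_le_s18
      (sub_nonneg.2 (inv_anti₀ hg2 hg.le)) hT R2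
    rw [Gul_eq_separated, Gul_eq_separated, sub_add_cancel]
    linarith
  · rw [sub_mul, hprod, one_mul, hB]
    field_simp
    ring
  · rw [hB]
    field_simp
end
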